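/- Let 0 < j < 3^n − 1 and let h = (3^k+1)j mod (3^n−1) with ternary digits h_i. Suppose j ∈ S_0, h_0 = h_1 = 1, and the ternary digits of j satisfy (j_1, j_0) = (1, 0). Then j_{ik mod n} = 1 for all w ≤ i ≤ n−1; j_{ik mod n} = 0 for i ∈ {0, w−1}; j_{ik mod n} ∈ {0, 2} for all 1 ≤ i ≤ w−2; and no two consecutive terms of the sequence j_{k mod n}, j_{2k mod n}, …, j_{(w−2)k mod n} both equal 2. -/

import Mathlib

/-- The `i`-th ternary digit (indices read modulo `n`) of the residue of `j` modulo `3^n - 1`. -/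
def dig (n : ℕ) (j : ℤ) (i : ℕ) : ℕ :=
  ((j % ((3 : ℤ) ^ n - 1)).toNat / 3 ^ (i % n)) % 3

/-- The ternary weight of (the residue modulo `3^n - 1` of) `j`. -/
def wt (n : ℕ) (j : ℤ) : ℕ := ∑ i ∈ Finset.range n, dig n j i

/-- `d = (3^k + 1)/2`. -/
def cmD (k : ℕ) : ℤ := ((3 : ℤ) ^ k + 1) / 2

/-- The set `S_0`. -/
def S0 (n k : ℕ) : Set ℤ :=
  {j | 0 < j ∧ j < 3 ^ n - 1 ∧
    wt n j + wt n (3 ^ k * j) = wt n ((3 ^ k + 1) * j) ∧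
    2 * wt n (-(j * cmD k)) = wt n (-((3 ^ k + 1) * j)) + 2}

theorem dig_lt_three (n : ℕ) (a : ℤ) (i : ℕ) : dig n a i < 3 :=
  Nat.mod_lt _ (by norm_num)

theorem dig_congr (n : ℕ) (a : ℤ) {i l : ℕ} (h : i ≡ l [MOD n]) : dig n a i = dig n a l := by
  unfold dig
  rw [h]

/-- The residue of `a` modulo `3 ^ n - 1` as a natural number, with its ternary digits. -/
theorem exists_residue {n : ℕ} (hn : 0 < n) (a : ℤ) :
    ∃ x : ℕ, x + 1 < 3 ^ n ∧ a % ((3 : ℤ) ^ n - 1) = x ∧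
      ∀ i < n, dig n a i = x / 3 ^ i % 3 := by
  have h3 : (3 : ℤ) ≤ 3 ^ n := by
    simpa using pow_le_pow_right₀ (by norm_num : (1 : ℤ) ≤ 3) hn
  have hnn := Int.emod_nonneg a (b := (3 : ℤ) ^ n - 1) (by omega)
  have hlt := Int.emod_lt_of_pos a (b := (3 : ℤ) ^ n - 1) (by omega)
  refine ⟨(a % ((3 : ℤ) ^ n - 1)).toNat, ?_, (Int.toNat_of_nonneg hnn).symm, fun i hi => ?_⟩
  · zify
    rw [Int.toNat_of_nonneg hnn]
    omega
  · rw [dig, Nat.mod_eq_of_lt hi]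

theorem dig_eq_of_modEq {n : ℕ} {a : ℤ} {x : ℕ} (hx : x + 1 < 3 ^ n)
    (h : a ≡ x [ZMOD 3 ^ n - 1]) {i : ℕ} (hi : i < n) : dig n a i = x / 3 ^ i % 3 := by
  have hx' : (x : ℤ) + 1 < 3 ^ n := by exact_mod_cast hx
  rw [dig, Nat.mod_eq_of_lt hi, h, Int.emod_eq_of_lt (by positivity) (by omega), Int.toNat_natCast]

/-- Addition modulo `3 ^ n - 1` is digitwise addition with cyclic carries. -/
theorem exists_carry {n : ℕ} (hn : 0 < n) (a b : ℤ) :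
    ∃ c : ℕ → ℕ, c 0 = c n ∧ (∀ i, c i ≤ 1) ∧
      ∀ i < n, dig n a i + dig n b i + c i = dig n (a + b) i + 3 * c (i + 1) := by
  obtain ⟨x, hx, hxa, hdx⟩ := exists_residue hn a
  obtain ⟨y, hy, hyb, hdy⟩ := exists_residue hn b
  obtain ⟨e, s, he, hs, hxy⟩ : ∃ e s : ℕ, e ≤ 1 ∧ s + 1 < 3 ^ n ∧ x + y + e = s + 3 ^ n * e := by
    by_cases hc : x + y + 1 < 3 ^ n
    · exact ⟨0, x + y, by omega, hc, by simp⟩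
    · exact ⟨1, x + y + 1 - 3 ^ n, by omega, by omega, by omega⟩
  have hab : a + b ≡ s [ZMOD 3 ^ n - 1] := by
    have h1 : a ≡ x [ZMOD 3 ^ n - 1] := by rw [← hxa]; exact (Int.mod_modEq _ _).symm
    have h2 : b ≡ y [ZMOD 3 ^ n - 1] := by rw [← hyb]; exact (Int.mod_modEq _ _).symm
    refine (h1.add h2).trans (Int.modEq_iff_dvd.mpr ⟨-e, ?_⟩)
    have hxy' : (x : ℤ) + y + e = s + 3 ^ n * e := by exact_mod_cast hxy
    linear_combination -hxy'
  refine ⟨fun i => (x % 3 ^ i + y % 3 ^ i + e) / 3 ^ i, ?_, fun i => ?_, fun i hi => ?_⟩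
  · simp only [pow_zero, Nat.mod_one, Nat.div_one, zero_add]
    rw [Nat.mod_eq_of_lt (by omega : x < 3 ^ n), Nat.mod_eq_of_lt (by omega : y < 3 ^ n), hxy,
      Nat.add_mul_div_left _ _ (by positivity), Nat.div_eq_of_lt (by omega), zero_add]
  · have h1 := Nat.mod_lt x (by positivity : 0 < 3 ^ i)
    have h2 := Nat.mod_lt y (by positivity : 0 < 3 ^ i)
    refine Nat.lt_succ_iff.mp ((Nat.div_lt_iff_lt_mul (by positivity)).mpr ?_)
    omega
  · rw [hdx i hi, hdy i hi, dig_eq_of_modEq hs hab hi]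
    have hcarry : (x % 3 ^ (i + 1) + y % 3 ^ (i + 1) + e) / 3 ^ (i + 1) =
        ((x % 3 ^ i + y % 3 ^ i + e) / 3 ^ i + (x / 3 ^ i % 3 + y / 3 ^ i % 3)) / 3 := by
      rw [← Nat.add_mul_div_left _ _ (by positivity : 0 < 3 ^ i), Nat.div_div_eq_div_mul,
        ← pow_succ, Nat.mod_pow_succ, Nat.mod_pow_succ]
      congr 1
      ring
    have hsum : (x + y + e) / 3 ^ i =
        (x % 3 ^ i + y % 3 ^ i + e) / 3 ^ i + (x / 3 ^ i + y / 3 ^ i) := by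
      rw [← Nat.add_mul_div_left _ _ (by positivity : 0 < 3 ^ i)]
      congr 1
      have h1 := Nat.mod_add_div x (3 ^ i)
      have h2 := Nat.mod_add_div y (3 ^ i)
      rw [mul_add]
      omega
    have hdigit : (x + y + e) / 3 ^ i % 3 = s / 3 ^ i % 3 := by
      obtain ⟨t, rfl⟩ : ∃ t, n = i + 1 + t := ⟨n - (i + 1), by omega⟩
      rw [hxy, show s + 3 ^ (i + 1 + t) * e = s + 3 ^ i * (3 * (3 ^ t * e)) by ring,
        Nat.add_mul_div_left _ _ (by positivity), Nat.add_mul_mod_self_left]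
    simp only [hcarry]
    omega

/-- The carries of an addition modulo `3 ^ n - 1` account for the loss of weight. -/
theorem exists_carry_wt {n : ℕ} (hn : 0 < n) (a b : ℤ) :
    ∃ c : ℕ → ℕ, c 0 = c n ∧ (∀ i, c i ≤ 1) ∧
      (∀ i < n, dig n a i + dig n b i + c i = dig n (a + b) i + 3 * c (i + 1)) ∧
      wt n a + wt n b = wt n (a + b) + 2 * ∑ i ∈ Finset.range n, c i := by
  obtain ⟨c, hc, hle, hdig⟩ := exists_carry hn a b
  refine ⟨c, hc, hle, hdig, ?_⟩
  have hsum := Finset.sum_congr rfl fun i hi => hdig i (Finset.mem_range.mp hi)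
  simp only [Finset.sum_add_distrib, ← Finset.mul_sum] at hsum
  have hshift := Finset.sum_range_succ c n
  rw [Finset.sum_range_succ'] at hshift
  unfold wt
  omega

theorem dig_add_of_wt_add {n : ℕ} (hn : 0 < n) {a b : ℤ}
    (h : wt n a + wt n b = wt n (a + b)) (i : ℕ) :
    dig n (a + b) i = dig n a i + dig n b i := by
  obtain ⟨c, hc, -, hdig, hwt⟩ := exists_carry_wt hn a b
  have hzero : ∀ i < n, c i = 0 := by
    have : ∑ i ∈ Finset.range n, c i = 0 := by omega
    simpa using this
  have key : ∀ i < n, dig n (a + b) i = dig n a i + dig n b i := by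
    intro i hi
    have h1 := hdig i hi
    have h2 := hzero i hi
    have h3 : c (i + 1) = 0 := by
      rcases Nat.lt_or_ge (i + 1) n with h | h
      · exact hzero _ h
      · rw [show i + 1 = n by omega, ← hc, hzero 0 hn]
    omega
  have hmod := (Nat.mod_modEq i n).symm
  simpa only [dig_congr n _ hmod] using key _ (Nat.mod_lt i hn)

theorem dig_neg {n : ℕ} (hn : 0 < n) {a : ℤ} (h0 : dig n a 0 ≠ 0) {i : ℕ} (hi : i < n) :
    dig n a i + dig n (-a) i = 2 := by
  obtain ⟨c, hc, hle, hdig⟩ := exists_carry hn a (-a)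
  have hzero : ∀ i, dig n (a + -a) i = 0 := by simp [dig]
  have hstep : ∀ i < n, c (i + 1) = 1 := by
    intro i
    induction i with
    | zero =>
      intro h
      have := hdig 0 h
      have := hle 1
      rw [hzero] at *
      simp only [zero_add] at *
      omega
    | succ i ih =>
      intro h
      have := ih (by omega)
      have := hdig _ h
      have := hle (i + 1 + 1)
      rw [hzero] at *
      omega
  have hci : c i = 1 := by
    cases i with
    | zero =>
      have := hstep (n - 1) (by omega)
      rwa [Nat.sub_add_cancel hn, ← hc] at this
    | succ i => exact hstep i (by omega)
  have h1 := hdig i hi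
  rw [hzero, hci, hstep i hi] at h1
  omega

theorem dig_three_mul {n : ℕ} (hn : 0 < n) (a : ℤ) (i : ℕ) :
    dig n (3 * a) (i + 1) = dig n a i := by
  obtain ⟨m, rfl⟩ : ∃ m, n = m + 1 := ⟨n - 1, by omega⟩
  obtain ⟨x, hx, hxa, hdx⟩ := exists_residue hn a
  have hdecomp := Nat.mod_add_div x (3 ^ m)
  have hr := Nat.mod_lt x (by positivity : 0 < 3 ^ m)
  have ht : x / 3 ^ m < 3 := by
    rw [Nat.div_lt_iff_lt_mul (by positivity)]
    rw [pow_succ] at hx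
    omega
  set r := x % 3 ^ m
  set t := x / 3 ^ m with htdef
  clear_value r t
  have hy : 3 * r + t + 1 < 3 ^ (m + 1) := by
    rw [pow_succ] at hx ⊢
    interval_cases t <;> omega
  have hmod : 3 * a ≡ ((3 * r + t : ℕ) : ℤ) [ZMOD 3 ^ (m + 1) - 1] := by
    have h1 : a ≡ x [ZMOD 3 ^ (m + 1) - 1] := by rw [← hxa]; exact (Int.mod_modEq _ _).symm
    refine (h1.mul_left 3).trans (Int.modEq_iff_dvd.mpr ⟨-t, ?_⟩)
    have hd : (r : ℤ) + 3 ^ m * t = x := by exact_mod_cast hdecomp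
    push_cast
    linear_combination 3 * hd
  have hdig := @dig_eq_of_modEq (m + 1) _ _ hy hmod
  have key : ∀ i < m + 1, dig (m + 1) (3 * a) (i + 1) = dig (m + 1) a i := by
    intro i hi
    rw [hdx i hi]
    rcases Nat.lt_or_ge i m with h | h
    · rw [hdig (by omega : i + 1 < m + 1), pow_succ', ← Nat.div_div_eq_div_mul,
        show (3 * r + t) / 3 = r by omega]
      obtain ⟨l, rfl⟩ : ∃ l, m = i + 1 + l := ⟨m - (i + 1), by omega⟩
      rw [← hdecomp, show r + 3 ^ (i + 1 + l) * t = r + 3 ^ i * (3 * (3 ^ l * t)) by ring,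
        Nat.add_mul_div_left _ _ (by positivity), Nat.add_mul_mod_self_left]
    · obtain rfl : i = m := by omega
      rw [dig_congr (i + 1) (3 * a) (l := 0) (by simp [Nat.ModEq]), hdig hn, ← htdef]
      simp
  have hmi := (Nat.mod_modEq i (m + 1)).symm
  rw [dig_congr _ a hmi, dig_congr _ _ (hmi.add_right 1)]
  exact key _ (Nat.mod_lt i hn)

theorem dig_three_pow_mul {n : ℕ} (hn : 0 < n) (a : ℤ) (k i : ℕ) :
    dig n (3 ^ k * a) (i + k) = dig n a i := by
  induction k with
  | zero => simp
  | succ k ih => rw [pow_succ', mul_assoc, ← add_assoc, dig_three_mul hn, ih]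

/-- If doubling `b` loses weight exactly two, at most two adjacent digits of `2 * b` are odd. -/
theorem even_dig_of_two_mul_wt {n : ℕ} (hn : 0 < n) {b : ℤ}
    (h : 2 * wt n b = wt n (b + b) + 2) (h0 : Odd (dig n (b + b) 0))
    (h1 : Odd (dig n (b + b) 1)) {i : ℕ} (h2i : 2 ≤ i) (hin : i < n) :
    Even (dig n (b + b) i) := by
  obtain ⟨c, hc, hle, hdig, hwt⟩ := exists_carry_wt hn b b
  have hsum : ∑ i ∈ Finset.range n, c i = 1 := by omega
  have hpair : ∀ l m, l < n → m < n → l ≠ m → c l + c m ≤ 1 := by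
    intro l m hl hm hlm
    rw [← hsum, ← Finset.sum_pair hlm]
    refine Finset.sum_le_sum_of_subset fun x hx => ?_
    simp only [Finset.mem_insert, Finset.mem_singleton] at hx
    rcases hx with rfl | rfl <;> simpa
  have d0 := hdig 0 (by omega)
  have d1 := hdig 1 (by omega)
  have di := hdig i hin
  have p02 := hpair 0 2 (by omega) (by omega) (by omega)
  have p1i := hpair 1 i (by omega) (by omega) (by omega)
  have hle1 := hle 1
  have hc1 : c 1 = 1 := by
    rw [Nat.odd_iff] at h0 h1
    simp only [zero_add, Nat.reduceAdd] at d0 d1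
    omega
  have hnext : c (i + 1) = 0 := by
    rcases Nat.lt_or_ge (i + 1) n with h' | h'
    · have := hpair 1 (i + 1) (by omega) h' (by omega)
      omega
    · have := hpair 0 1 (by omega) (by omega) (by omega)
      rw [show i + 1 = n by omega, ← hc]
      omega
  rw [Nat.even_iff]
  omega

theorem two_mul_cmD (k : ℕ) : 2 * cmD k = 3 ^ k + 1 := by
  have h : Even ((3 : ℤ) ^ k + 1) := (Odd.pow (by decide)).add_odd odd_one
  exact Int.two_mul_ediv_two_of_even h

theorem stmt1 (n k : ℕ) (hn : 2 ≤ n) (hkodd : Odd k) (hk0 : 0 < k) (hkn : k < n)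
    (hgcd : Nat.gcd n k = 1) (w : ℕ) (hw0 : 0 < w) (hwn : w < n) (hwk : w * k ≡ 1 [MOD n])
    (j : ℤ) (hj : j ∈ S0 n k)
    (h0 : dig n ((3 ^ k + 1) * j) 0 = 1) (h1 : dig n ((3 ^ k + 1) * j) 1 = 1)
    (hj1 : dig n j 1 = 1) (hj0 : dig n j 0 = 0) :
    (∀ i, w ≤ i → i ≤ n - 1 → dig n j (i * k) = 1) ∧
    dig n j 0 = 0 ∧ dig n j ((w - 1) * k) = 0 ∧
    (∀ i, 1 ≤ i → i ≤ w - 2 → dig n j (i * k) = 0 ∨ dig n j (i * k) = 2) ∧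
    (∀ i, 1 ≤ i → i + 1 ≤ w - 2 →
      ¬(dig n j (i * k) = 2 ∧ dig n j ((i + 1) * k) = 2)) := by
  have hnpos : 0 < n := by omega
  obtain ⟨-, -, hwt, hwtd⟩ := hj
  have hadd : ∀ i, dig n ((3 ^ k + 1) * j) (i + k) = dig n j (i + k) + dig n j i := by
    intro i
    have hsplit : ((3 : ℤ) ^ k + 1) * j = j + 3 ^ k * j := by ring
    rw [hsplit] at hwt ⊢
    rw [dig_add_of_wt_add hnpos hwt, dig_three_pow_mul hnpos]
  have heven : ∀ i, 2 ≤ i → i < n → Even (dig n ((3 ^ k + 1) * j) i) := by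
    intro i h2i hin
    have hdouble : -((3 ^ k + 1) * j) = -(j * cmD k) + -(j * cmD k) := by
      linear_combination j * two_mul_cmD k
    have hneg : ∀ i < n, dig n ((3 ^ k + 1) * j) i +
        dig n (-(j * cmD k) + -(j * cmD k)) i = 2 := by
      intro i hi
      rw [← hdouble]
      exact dig_neg hnpos (by omega) hi
    have n0 := hneg 0 (by omega)
    have n1 := hneg 1 (by omega)
    have ni := hneg i hin
    rw [hdouble] at hwtd
    have := even_dig_of_two_mul_wt hnpos hwtd (by rw [Nat.odd_iff]; omega)
      (by rw [Nat.odd_iff]; omega) h2i hin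
    rw [Nat.even_iff] at this ⊢
    omega
  have hstep : ∀ i, dig n ((3 ^ k + 1) * j) ((i + 1) * k) =
      dig n j ((i + 1) * k) + dig n j (i * k) := by
    intro i
    rw [add_one_mul i k]
    exact hadd _
  have hinj : ∀ a b, a < n → b < n → a * k ≡ b * k [MOD n] → a = b := fun a b ha hb hab =>
    (Nat.ModEq.cancel_right_of_coprime hgcd hab).eq_of_lt_of_lt ha hb
  have hparity : ∀ i, i + 1 < n → i + 1 ≠ w →
      Even (dig n j ((i + 1) * k) + dig n j (i * k)) := by
    intro i hin hiw
    have hm := (Nat.mod_modEq ((i + 1) * k) n).symm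
    rw [← hstep, dig_congr n _ hm]
    refine heven _ ?_ (Nat.mod_lt _ hnpos)
    by_contra hlt
    obtain h | h : (i + 1) * k % n = 0 ∨ (i + 1) * k % n = 1 := by omega
    · rw [h] at hm
      have := hinj (i + 1) 0 hin hnpos (by simpa using hm)
      omega
    · rw [h] at hm
      exact hiw (hinj _ _ hin hwn (hm.trans hwk.symm))
  have haw : dig n j (w * k) = 1 := by rw [dig_congr n j hwk, hj1]
  have hpred : dig n j ((w - 1) * k) = 0 := by
    have h := hstep (w - 1)
    rw [Nat.sub_add_cancel hw0, haw, dig_congr n _ hwk, h1] at h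
    omega
  have hlow : ∀ i, i < w → Even (dig n j (i * k)) := by
    intro i
    induction i with
    | zero => simp [hj0]
    | succ i ih =>
      intro hi
      exact (Nat.even_add.mp (hparity i (by omega) (by omega))).mpr (ih (by omega))
  have hhigh : ∀ i, w ≤ i → i < n → Odd (dig n j (i * k)) := by
    intro i hi
    induction i, hi using Nat.le_induction with
    | base => simp [haw]
    | succ i hi ih =>
      intro hin
      have h := Nat.even_add.mp (hparity i hin (by omega))
      rw [← Nat.not_even_iff_odd] at ih ⊢
      exact fun h' => ih (by omega) (h.mp h')
  refine ⟨fun i hi hin => ?_, hj0, hpred, fun i _ hi => ?_, fun i _ _ h => ?_⟩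
  · have := hhigh i hi (by omega)
    have := dig_lt_three n j (i * k)
    rw [Nat.odd_iff] at *
    omega
  · have := hlow i (by omega)
    have := dig_lt_three n j (i * k)
    rw [Nat.even_iff] at *
    omega
  · have h := hstep i
    have := dig_lt_three n ((3 ^ k + 1) * j) ((i + 1) * k)
    omega
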